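/- Assume A ≠ ∅, A ⊆ Ŝ_O, and that the zero-distortion reconstruction sets R_Cn(a) := {ŝ ∈ Ŝ_O : Cn((S_O \ {a}) ∪ {ŝ}) = Cn(S_O)} are pairwise disjoint for distinct a ∈ A. Then the closure-based zero-distortion rate satisfies R_sem(0) = P_A·H(π_A), with the convention that the right-hand side is 0 when P_A = 0. In particular, every test channel achieving zero closure distortion has mutual information at least P_A·H(π_A), and this value is attained. -/

import Mathlib

open scoped BigOperators Classical

noncomputable section

variable {𝕊 : Type*} [Fintype 𝕊]

/-- One step of the deletion procedure. -/
def atomStep (Cn : Set 𝕊 → Set 𝕊) (A : Set 𝕊) (s : 𝕊) : Set 𝕊 :=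
  if s ∈ Cn (A \ {s}) then A \ {s} else A

/-- The deletion procedure; `Atom(S_O) = atomCore Cn S_O L`. -/
def atomCore (Cn : Set 𝕊 → Set 𝕊) (S : Set 𝕊) (L : List 𝕊) : Set 𝕊 :=
  L.foldl (atomStep Cn) S

/-- Shannon entropy of a probability vector on a finite type
(natural logarithm; `Real.log 0 = 0` handles the `0·log 0 := 0` convention). -/
def entropy {X : Type*} [Fintype X] (p : X → ℝ) : ℝ :=
  -∑ x, p x * Real.log (p x)

/-- Mutual information `I(p,W) := H(p) + H(q̂) − H(q)` of a source `p` and a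
channel `W`, where `q(x,y) = p(x)·W(y|x)` and `q̂` is the output marginal. -/
def mutualInfo {X Y : Type*} [Fintype X] [Fintype Y]
    (p : X → ℝ) (W : X → Y → ℝ) : ℝ :=
  entropy p + entropy (fun y => ∑ x, p x * W x y)
    - entropy (fun z : X × Y => p z.1 * W z.1 z.2)

/-- A test channel into the alphabet `Yset`: rows are probability vectors
supported inside `Yset`. -/
def IsChannel {X Y : Type*} [Fintype Y] (W : X → Y → ℝ) (Yset : Set Y) : Prop :=
  (∀ x y, 0 ≤ W x y) ∧ (∀ x, ∑ y, W x y = 1) ∧ (∀ x y, W x y ≠ 0 → y ∈ Yset)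

/-- A probability vector supported on `S`. -/
def IsProbVector {X : Type*} [Fintype X] (p : X → ℝ) (S : Set X) : Prop :=
  (∀ x, 0 ≤ p x) ∧ (∑ x, p x = 1) ∧ (∀ x, p x ≠ 0 → x ∈ S)

/-- The probability mass `p(A)` of a set `A`. -/
def massOn {X : Type*} [Fintype X] (p : X → ℝ) (A : Set X) : ℝ :=
  ∑ x, if x ∈ A then p x else 0

/-- The conditional distribution of `p` given `A`. -/
def condOn {X : Type*} [Fintype X] (p : X → ℝ) (A : Set X) : X → ℝ :=
  fun x => if x ∈ A then p x / massOn p A else 0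

/-- Zero-distortion reconstruction set
`R_Cn(s) := {shat ∈ Shat_O : Cn((S_O \ {s}) ∪ {shat}) = Cn(S_O)}`. -/
def RCn (Cn : Set 𝕊 → Set 𝕊) (S_O Shat_O : Set 𝕊) (s : 𝕊) : Set 𝕊 :=
  {shat ∈ Shat_O | Cn ((S_O \ {s}) ∪ {shat}) = Cn S_O}

/-- The channel `W` achieves zero closure distortion for the source `p`. -/
def ZeroClosureDist (Cn : Set 𝕊 → Set 𝕊) (S_O : Set 𝕊)
    (p : 𝕊 → ℝ) (W : 𝕊 → 𝕊 → ℝ) : Prop :=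
  ∀ s : 𝕊, 0 < p s → ∀ shat : 𝕊, 0 < W s shat →
    Cn ((S_O \ {s}) ∪ {shat}) = Cn S_O

/-- `R_sem(0)`: the infimum of `I(p,W)` over all zero-closure-distortion test
channels from `S_O` to `Shat_O` (infimum of the empty set is `⊤ = +∞`). -/
def RsemZero (Cn : Set 𝕊 → Set 𝕊) (S_O Shat_O : Set 𝕊) (p : 𝕊 → ℝ) : EReal :=
  sInf {r : EReal | ∃ W : 𝕊 → 𝕊 → ℝ, IsChannel W Shat_O ∧
    ZeroClosureDist Cn S_O p W ∧ r = ((mutualInfo p W : ℝ) : EReal)}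

theorem atomCore_subset {T : Type*} (Cn : Set T → Set T) (L : List T) (S : Set T) :
    atomCore Cn S L ⊆ S := by
  induction L generalizing S with
  | nil => exact subset_rfl
  | cons s L ih =>
    refine (ih (atomStep Cn S s)).trans ?_
    unfold atomStep
    split_ifs
    · exact Set.sdiff_subset
    · exact subset_rfl

theorem closure_atomStep {T : Type*} {Cn : Set T → Set T}
    (hrefl : ∀ Γ : Set T, Γ ⊆ Cn Γ)
    (hmono : ∀ Γ Γ' : Set T, Γ ⊆ Γ' → Cn Γ ⊆ Cn Γ')
    (hidem : ∀ Γ : Set T, Cn (Cn Γ) = Cn Γ) (A : Set T) (s : T) :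
    Cn (atomStep Cn A s) = Cn A := by
  unfold atomStep
  split_ifs with h
  · refine (hmono _ _ Set.sdiff_subset).antisymm ?_
    rw [← hidem (A \ {s})]
    refine hmono _ _ fun x hx => ?_
    by_cases hxs : x = s
    · exact hxs ▸ h
    · exact hrefl _ ⟨hx, hxs⟩
  · rfl

theorem closure_atomCore {T : Type*} {Cn : Set T → Set T}
    (hrefl : ∀ Γ : Set T, Γ ⊆ Cn Γ)
    (hmono : ∀ Γ Γ' : Set T, Γ ⊆ Γ' → Cn Γ ⊆ Cn Γ')
    (hidem : ∀ Γ : Set T, Cn (Cn Γ) = Cn Γ) (L : List T) (S : Set T) :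
    Cn (atomCore Cn S L) = Cn S := by
  induction L generalizing S with
  | nil => rfl
  | cons s L ih =>
    exact (ih (atomStep Cn S s)).trans (closure_atomStep hrefl hmono hidem S s)

/-- Replacing a symbol outside a generating subset `A ⊆ S` by any symbol of `S` preserves the
closure. -/
theorem closure_replace_of_notMem {T : Type*} {Cn : Set T → Set T}
    (hmono : ∀ Γ Γ' : Set T, Γ ⊆ Γ' → Cn Γ ⊆ Cn Γ') {A S : Set T} (hAS : A ⊆ S)
    (hA : Cn A = Cn S) {s t : T} (hs : s ∉ A) (ht : t ∈ S) :
    Cn ((S \ {s}) ∪ {t}) = Cn S := by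
  refine (hmono _ _ ?_).antisymm ?_
  · exact Set.union_subset Set.sdiff_subset (Set.singleton_subset_iff.2 ht)
  · rw [← hA]
    refine hmono _ _ fun x hx => Or.inl ⟨hAS hx, ?_⟩
    rintro rfl
    exact hs hx

theorem closure_replace_self {T : Type*} (Cn : Set T → Set T) {S : Set T} {s : T}
    (hs : s ∈ S) : Cn ((S \ {s}) ∪ {s}) = Cn S := by
  rw [Set.sdiff_union_of_subset (Set.singleton_subset_iff.2 hs)]

theorem sub_le_mul_log_sub_log {a b : ℝ} (ha : 0 ≤ a) (hb : 0 ≤ b) (hab : a ≠ 0 → b ≠ 0) :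
    a - b ≤ a * (Real.log a - Real.log b) := by
  rcases ha.eq_or_lt with rfl | ha'
  · simpa using hb
  have hb' : 0 < b := hb.lt_of_ne' (hab ha'.ne')
  have h := Real.log_le_sub_one_of_pos (div_pos hb' ha')
  rw [Real.log_div hb'.ne' ha'.ne'] at h
  have h2 := mul_le_mul_of_nonneg_left h ha
  have h3 : a * (b / a - 1) = b - a := by field_simp
  rw [h3] at h2
  linarith

section Information

variable {X Y : Type*} [Fintype X] [Fintype Y]

theorem mutualInfo_eq_sum (p : X → ℝ) (W : X → Y → ℝ)
    (hW1 : ∀ x, ∑ y, W x y = 1) :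
    mutualInfo p W =
      ∑ x, ∑ y, p x * W x y * (Real.log (W x y) - Real.log (∑ x', p x' * W x' y)) := by
  have h1 : ∑ x, p x * Real.log (p x) = ∑ x, ∑ y, p x * W x y * Real.log (p x) := by
    refine Finset.sum_congr rfl fun x _ => ?_
    rw [← Finset.sum_mul, ← Finset.mul_sum, hW1, mul_one]
  have h2 : ∑ y, (∑ x, p x * W x y) * Real.log (∑ x, p x * W x y)
      = ∑ x, ∑ y, p x * W x y * Real.log (∑ x', p x' * W x' y) := by
    rw [Finset.sum_comm]
    exact Finset.sum_congr rfl fun y _ => Finset.sum_mul _ _ _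
  unfold mutualInfo entropy
  rw [Fintype.sum_prod_type, h1, h2, sub_neg_eq_add, ← Finset.sum_neg_distrib,
    ← Finset.sum_neg_distrib, ← Finset.sum_add_distrib, ← Finset.sum_add_distrib]
  refine Finset.sum_congr rfl fun x _ => ?_
  rw [← Finset.sum_neg_distrib, ← Finset.sum_neg_distrib, ← Finset.sum_add_distrib,
    ← Finset.sum_add_distrib]
  refine Finset.sum_congr rfl fun y _ => ?_
  rcases eq_or_ne (p x) 0 with h | h
  · simp [h]
  rcases eq_or_ne (W x y) 0 with h' | h'
  · simp [h']
  rw [Real.log_mul h h']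
  ring

theorem massOn_nonneg {p : X → ℝ} (hp : ∀ x, 0 ≤ p x) (A : Set X) : 0 ≤ massOn p A :=
  Finset.sum_nonneg fun x _ => by split_ifs <;> simp [hp x]

theorem le_massOn {p : X → ℝ} (hp : ∀ x, 0 ≤ p x) {A : Set X} {a : X} (ha : a ∈ A) :
    p a ≤ massOn p A := by
  have h := Finset.single_le_sum (f := fun x => if x ∈ A then p x else 0)
    (fun x _ => by split_ifs <;> simp [hp x]) (Finset.mem_univ a)
  simpa [ha, massOn] using h

theorem eq_zero_of_massOn_eq_zero {p : X → ℝ} (hp : ∀ x, 0 ≤ p x) {A : Set X}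
    (hA : massOn p A = 0) {a : X} (ha : a ∈ A) : p a = 0 :=
  le_antisymm (hA ▸ le_massOn hp ha) (hp a)

theorem massOn_mul_condOn {p : X → ℝ} (hp : ∀ x, 0 ≤ p x) (A : Set X) (x : X) :
    massOn p A * condOn p A x = if x ∈ A then p x else 0 := by
  unfold condOn
  split_ifs with hx
  · rcases eq_or_ne (massOn p A) 0 with h | h
    · rw [h, zero_mul, eq_zero_of_massOn_eq_zero hp h hx]
    · exact mul_div_cancel₀ _ h
  · simp

theorem sum_condOn {p : X → ℝ} {A : Set X} (hA : massOn p A ≠ 0) : ∑ x, condOn p A x = 1 := by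
  have h : ∀ x, condOn p A x = (if x ∈ A then p x else 0) / massOn p A := fun x => by
    unfold condOn
    split_ifs <;> simp
  simp_rw [h]
  rw [← Finset.sum_div]
  exact div_self hA

theorem condOn_nonneg {p : X → ℝ} (hp : ∀ x, 0 ≤ p x) (A : Set X) (x : X) :
    0 ≤ condOn p A x := by
  unfold condOn
  split_ifs
  · exact div_nonneg (hp x) (massOn_nonneg hp A)
  · exact le_rfl

theorem massOn_mul_entropy_condOn {p : X → ℝ} (hp : ∀ x, 0 ≤ p x) (A : Set X) :
    massOn p A * entropy (condOn p A) =
      ∑ x, if x ∈ A then -(p x * Real.log (condOn p A x)) else 0 := by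
  unfold entropy
  rw [mul_neg, Finset.mul_sum, ← Finset.sum_neg_distrib]
  refine Finset.sum_congr rfl fun x _ => ?_
  rw [← mul_assoc, massOn_mul_condOn hp]
  split_ifs <;> simp

theorem sum_indicator_le_of_disjoint {q : Y → ℝ} (hq : ∀ y, 0 ≤ q y) {A : Set X}
    {R : X → Set Y} (hR : ∀ a ∈ A, ∀ b ∈ A, a ≠ b → R a ∩ R b = ∅) :
    ∑ x, (if x ∈ A then ∑ y, (if y ∈ R x then q y else 0) else 0) ≤ ∑ y, q y := by
  have h : ∀ x, (if x ∈ A then ∑ y, (if y ∈ R x then q y else 0) else 0)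
      = ∑ y, if x ∈ A ∧ y ∈ R x then q y else 0 := fun x => by
    by_cases hx : x ∈ A <;> simp [hx]
  simp_rw [h]
  rw [Finset.sum_comm]
  refine Finset.sum_le_sum fun y _ => ?_
  by_cases hy : ∃ a, a ∈ A ∧ y ∈ R a
  · obtain ⟨a, ha, hya⟩ := hy
    rw [Finset.sum_eq_single a]
    · simp [ha, hya]
    · rintro b - hba
      refine if_neg fun hb => ?_
      have : y ∈ R b ∩ R a := ⟨hb.2, hya⟩
      rw [hR b hb.1 a ha hba] at this
      exact this
    · simp
  · push Not at hy
    rw [Finset.sum_eq_zero]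
    · exact hq y
    · exact fun x _ => if_neg fun hx => hy x hx.1 hx.2

/-- If the rows of `W` indexed by `A` are supported in pairwise disjoint sets, the mutual
information is at least the entropy contribution of `A`. -/
theorem massOn_mul_entropy_condOn_le_mutualInfo {p : X → ℝ} {W : X → Y → ℝ}
    (hp : ∀ x, 0 ≤ p x) (hp1 : ∑ x, p x = 1) (hW : ∀ x y, 0 ≤ W x y)
    (hW1 : ∀ x, ∑ y, W x y = 1) {A : Set X} {R : X → Set Y}
    (hR : ∀ a ∈ A, ∀ b ∈ A, a ≠ b → R a ∩ R b = ∅)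
    (hWR : ∀ a ∈ A, 0 < p a → ∀ y, 0 < W a y → y ∈ R a) :
    massOn p A * entropy (condOn p A) ≤ mutualInfo p W := by
  rw [mutualInfo_eq_sum p W hW1, massOn_mul_entropy_condOn hp]
  set q : Y → ℝ := fun y => ∑ x', p x' * W x' y with hqdef
  have hq : ∀ y, 0 ≤ q y := fun y => Finset.sum_nonneg fun x _ => mul_nonneg (hp x) (hW x y)
  have hq1 : ∑ y, q y = 1 := by
    rw [hqdef, Finset.sum_comm]
    simp_rw [← Finset.mul_sum, hW1, mul_one, hp1]
  have hqpos : ∀ x y, p x * W x y ≠ 0 → 0 < q y := fun x y h =>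
    ((mul_nonneg (hp x) (hW x y)).lt_of_ne' h).trans_le
      (Finset.single_le_sum (f := fun x' => p x' * W x' y)
        (fun x' _ => mul_nonneg (hp x') (hW x' y)) (Finset.mem_univ x))
  have hrow : ∀ x, (if x ∈ A then -(p x * Real.log (condOn p A x)) else 0)
      + ((if x ∈ A then p x else 0)
        - massOn p A * (if x ∈ A then ∑ y, (if y ∈ R x then q y else 0) else 0))
      ≤ ∑ y, p x * W x y * (Real.log (W x y) - Real.log (q y)) := by
    intro x
    by_cases hx : x ∈ A
    · simp only [hx, if_true]
      have hterm : ∀ y, -(p x * W x y * Real.log (condOn p A x))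
          + (p x * W x y - massOn p A * (if y ∈ R x then q y else 0))
          ≤ p x * W x y * (Real.log (W x y) - Real.log (q y)) := by
        intro y
        by_cases h : p x * W x y = 0
        · rw [h]
          have : 0 ≤ massOn p A * (if y ∈ R x then q y else 0) :=
            mul_nonneg (massOn_nonneg hp A) (by split_ifs <;> simp [hq y])
          linarith
        · have hpx := left_ne_zero_of_mul h
          have hWx := right_ne_zero_of_mul h
          have hP : 0 < massOn p A := ((hp x).lt_of_ne' hpx).trans_le (le_massOn hp hx)
          have hy : y ∈ R x :=
            hWR x hx ((hp x).lt_of_ne' hpx) y ((hW x y).lt_of_ne' hWx)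
          have hqy := hqpos x y h
          have key := sub_le_mul_log_sub_log (mul_nonneg (hp x) (hW x y))
            (mul_pos hP hqy).le fun _ => (mul_pos hP hqy).ne'
          rw [Real.log_mul hpx hWx, Real.log_mul hP.ne' hqy.ne'] at key
          simp only [condOn, hx, hy, if_true]
          rw [Real.log_div hpx hP.ne']
          linarith
      refine le_trans (le_of_eq ?_) (Finset.sum_le_sum fun y _ => hterm y)
      rw [Finset.sum_add_distrib, Finset.sum_sub_distrib, Finset.sum_neg_distrib,
        ← Finset.sum_mul, ← Finset.mul_sum, ← Finset.mul_sum, hW1, mul_one]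
    · simp only [hx, if_false, mul_zero, sub_zero, add_zero]
      have hterm : ∀ y, p x * W x y - p x * q y
          ≤ p x * W x y * (Real.log (W x y) - Real.log (q y)) := by
        intro y
        rw [← mul_sub, mul_assoc]
        rcases (hp x).eq_or_lt with h | h
        · simp [← h]
        refine mul_le_mul_of_nonneg_left ?_ (hp x)
        exact sub_le_mul_log_sub_log (hW x y) (hq y) fun h' =>
          (hqpos x y (mul_ne_zero h.ne' h')).ne'
      refine le_trans (le_of_eq ?_) (Finset.sum_le_sum fun y _ => hterm y)
      rw [Finset.sum_sub_distrib, ← Finset.mul_sum, ← Finset.mul_sum, hW1, hq1, sub_self]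
  refine le_trans ?_ (Finset.sum_le_sum fun x _ => hrow x)
  rw [Finset.sum_add_distrib, Finset.sum_sub_distrib, ← Finset.mul_sum]
  have hsum := mul_le_mul_of_nonneg_left (sum_indicator_le_of_disjoint hq hR)
    (massOn_nonneg hp A)
  rw [hq1, mul_one] at hsum
  have hmass : ∑ x, (if x ∈ A then p x else 0) = massOn p A := rfl
  linarith

theorem sum_pi_single (x : X) : ∑ y, (Pi.single x 1 : X → ℝ) y = 1 := by
  simp

/-- The channel that transmits the symbols of `A` faithfully and outputs an independent sample of
the conditional distribution on `A` otherwise. -/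
def coreChannel (p : X → ℝ) (A : Set X) (x : X) : X → ℝ :=
  if x ∈ A then Pi.single x 1 else condOn p A

theorem coreChannel_nonneg {p : X → ℝ} (hp : ∀ x, 0 ≤ p x) (A : Set X) (x y : X) :
    0 ≤ coreChannel p A x y := by
  unfold coreChannel
  split_ifs
  · exact (Pi.single_nonneg.2 zero_le_one : (0 : X → ℝ) ≤ Pi.single x 1) y
  · exact condOn_nonneg hp A y

theorem sum_coreChannel {p : X → ℝ} {A : Set X} (hA : massOn p A ≠ 0) (x : X) :
    ∑ y, coreChannel p A x y = 1 := by
  unfold coreChannel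
  split_ifs
  · exact sum_pi_single x
  · exact sum_condOn hA

theorem mem_of_coreChannel_ne_zero {p : X → ℝ} {A : Set X} {x y : X}
    (h : coreChannel p A x y ≠ 0) : y ∈ A := by
  by_contra hy
  refine h ?_
  unfold coreChannel
  split_ifs with hx
  · exact Pi.single_eq_of_ne (fun hyx : y = x => hy (hyx ▸ hx)) _
  · simp [condOn, hy]

theorem coreChannel_output {p : X → ℝ} (hp : ∀ x, 0 ≤ p x) (hp1 : ∑ x, p x = 1) (A : Set X)
    (y : X) : ∑ x, p x * coreChannel p A x y = condOn p A y := by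
  have h : ∀ x, p x * coreChannel p A x y = (if x = y then (if y ∈ A then p y else 0) else 0)
      + (p x - if x ∈ A then p x else 0) * condOn p A y := by
    intro x
    unfold coreChannel
    by_cases hx : x ∈ A
    · by_cases hxy : x = y
      · subst hxy
        simp [hx]
      · simp [hx, hxy]
    · by_cases hxy : x = y
      · subst hxy
        simp [hx]
      · simp [hx, hxy]
  simp_rw [h]
  rw [Finset.sum_add_distrib, ← Finset.sum_mul, Finset.sum_sub_distrib, hp1,
    Finset.sum_ite_eq' Finset.univ y, if_pos (Finset.mem_univ y), ← massOn_mul_condOn hp]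
  change _ + (1 - massOn p A) * _ = _
  ring

theorem mutualInfo_coreChannel {p : X → ℝ} (hp : ∀ x, 0 ≤ p x) (hp1 : ∑ x, p x = 1)
    {A : Set X} (hA : massOn p A ≠ 0) :
    mutualInfo p (coreChannel p A) = massOn p A * entropy (condOn p A) := by
  rw [mutualInfo_eq_sum p _ (sum_coreChannel hA),
    massOn_mul_entropy_condOn hp]
  simp_rw [coreChannel_output hp hp1]
  refine Finset.sum_congr rfl fun x _ => ?_
  by_cases hx : x ∈ A
  · rw [if_pos hx, Finset.sum_eq_single x]
    · simp [coreChannel, hx]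
    · rintro y - hyx
      simp [coreChannel, hx, Pi.single_eq_of_ne hyx]
    · simp
  · simp [coreChannel, hx]

theorem mutualInfo_const {p : X → ℝ} (hp1 : ∑ x, p x = 1) {r : Y → ℝ}
    (hr1 : ∑ y, r y = 1) : mutualInfo p (fun _ => r) = 0 := by
  rw [mutualInfo_eq_sum p _ (fun _ => hr1)]
  simp_rw [← Finset.sum_mul, hp1]
  simp

end Information

/-- Exact zero-distortion rate: if `A ≠ ∅`, `A ⊆ Shat_O`,
and the zero-distortion reconstruction sets `R_Cn(a)` of distinct core symbols
are pairwise disjoint, then `R_sem(0) = P_A·H(π_A)` (the right-hand side being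
`0` when `P_A = 0`, which holds automatically since `π_A ≡ 0` in that case);
moreover every feasible channel has mutual information at least `P_A·H(π_A)`,
and this value is attained. -/
theorem exact_zero_distortion_rate
    (Cn : Set 𝕊 → Set 𝕊)
    (hrefl : ∀ Γ : Set 𝕊, Γ ⊆ Cn Γ)
    (hmono : ∀ Γ Γ' : Set 𝕊, Γ ⊆ Γ' → Cn Γ ⊆ Cn Γ')
    (hidem : ∀ Γ : Set 𝕊, Cn (Cn Γ) = Cn Γ)
    (S_O Shat_O : Set 𝕊) (L : List 𝕊)
    (hnodup : L.Nodup)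
    (henum : ∀ s : 𝕊, s ∈ L ↔ s ∈ S_O)
    (p : 𝕊 → ℝ) (hp : IsProbVector p S_O)
    (hAne : (atomCore Cn S_O L).Nonempty)
    (hAsub : atomCore Cn S_O L ⊆ Shat_O)
    (hdisj : ∀ a₁ ∈ atomCore Cn S_O L, ∀ a₂ ∈ atomCore Cn S_O L, a₁ ≠ a₂ →
      RCn Cn S_O Shat_O a₁ ∩ RCn Cn S_O Shat_O a₂ = ∅) :
    RsemZero Cn S_O Shat_O p =
        ((massOn p (atomCore Cn S_O L) *
            entropy (condOn p (atomCore Cn S_O L)) : ℝ) : EReal) ∧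
      (∀ W : 𝕊 → 𝕊 → ℝ, IsChannel W Shat_O → ZeroClosureDist Cn S_O p W →
        massOn p (atomCore Cn S_O L) *
            entropy (condOn p (atomCore Cn S_O L)) ≤ mutualInfo p W) ∧
      (∃ W : 𝕊 → 𝕊 → ℝ, IsChannel W Shat_O ∧ ZeroClosureDist Cn S_O p W ∧
        mutualInfo p W =
          massOn p (atomCore Cn S_O L) *
            entropy (condOn p (atomCore Cn S_O L))) := by
  set A := atomCore Cn S_O L with hAdef
  obtain ⟨hp0, hp1, hpS⟩ := hp
  have hAS : A ⊆ S_O := atomCore_subset Cn L S_O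
  have hCn : Cn A = Cn S_O := closure_atomCore hrefl hmono hidem L S_O
  have lower : ∀ W : 𝕊 → 𝕊 → ℝ, IsChannel W Shat_O → ZeroClosureDist Cn S_O p W →
      massOn p A * entropy (condOn p A) ≤ mutualInfo p W := by
    rintro W ⟨hW0, hW1, hWS⟩ hz
    exact massOn_mul_entropy_condOn_le_mutualInfo hp0 hp1 hW0 hW1 hdisj
      fun a _ hpa y hy => ⟨hWS a y hy.ne', hz a hpa y hy⟩
  have attained : ∃ W : 𝕊 → 𝕊 → ℝ, IsChannel W Shat_O ∧ ZeroClosureDist Cn S_O p W ∧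
      mutualInfo p W = massOn p A * entropy (condOn p A) := by
    by_cases hP : massOn p A = 0
    · obtain ⟨a, ha⟩ := hAne
      have hnonneg : ∀ y, 0 ≤ (Pi.single a 1 : 𝕊 → ℝ) y :=
        (Pi.single_nonneg.2 zero_le_one : (0 : 𝕊 → ℝ) ≤ Pi.single a 1)
      have hsupp : ∀ y, (Pi.single a 1 : 𝕊 → ℝ) y ≠ 0 → y = a := fun y hy => by
        by_contra h
        exact hy (Pi.single_eq_of_ne h _)
      refine ⟨fun _ => Pi.single a 1, ⟨fun _ => hnonneg, fun _ => sum_pi_single a,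
        fun _ y hy => hAsub (hsupp y hy ▸ ha)⟩, ?_, ?_⟩
      · intro s hs y hy
        refine closure_replace_of_notMem hmono hAS hCn (fun hsA => ?_)
          (hAS (hsupp y hy.ne' ▸ ha))
        exact hs.ne' (eq_zero_of_massOn_eq_zero hp0 hP hsA)
      · rw [mutualInfo_const hp1 (sum_pi_single a), hP, zero_mul]
    · refine ⟨coreChannel p A, ⟨coreChannel_nonneg hp0 A, sum_coreChannel hP,
        fun _ _ h => hAsub (mem_of_coreChannel_ne_zero h)⟩, ?_,
        mutualInfo_coreChannel hp0 hp1 hP⟩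
      intro s _ y hy
      by_cases hs : s ∈ A
      · obtain rfl : y = s := by
          by_contra hys
          simp [coreChannel, hs, Pi.single_eq_of_ne hys] at hy
        exact closure_replace_self Cn (hAS hs)
      · exact closure_replace_of_notMem hmono hAS hCn hs
          (hAS (mem_of_coreChannel_ne_zero hy.ne'))
  refine ⟨le_antisymm ?_ ?_, lower, attained⟩
  · obtain ⟨W, hW, hz, hI⟩ := attained
    exact sInf_le ⟨W, hW, hz, by rw [hI]⟩
  · refine le_sInf ?_
    rintro r ⟨W, hW, hz, rfl⟩
    exact EReal.coe_le_coe_iff.2 (lower W hW hz)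

end
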